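/- Under hypotheses (C1)–(C6), let R > 0 satisfy max{ λ·f̄_R·K + η1·γ1(1)·H_{1,R} + η2·γ2(1)·H_{2,R}, λ·f̄_R·K* + η1·‖γ1'‖_∞·H_{1,R} + η2·‖γ2'‖_∞·H_{2,R} } ≤ R, and assume T has no fixed point u ∈ P with ‖u‖ = R. Then for every u ∈ P with ‖u‖ = R and every σ > 1 one has σ·u ≠ T u, where Tu(t) := η1 γ1(t) h1[u] + η2 γ2(t) h2[u] + λ ∫₀¹ k(t,s) f(s, u(s), u'(s)) ds. -/

import Mathlib

open MeasureTheory Set Bornology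

noncomputable section

/-- The interval `[0,1]`. -/
abbrev I01 : Set ℝ := Set.Icc 0 1

/-- The space `C[0,1] × C[0,1]`; an element of `C¹[0,1]` is encoded as the pair `(u, u')`.
The product norm is exactly `‖(u,u')‖ = max {‖u‖_∞, ‖u'‖_∞}`. -/
abbrev E := C(I01, ℝ) × C(I01, ℝ)

/-- The extension to `ℝ` of a continuous function on `[0,1]` (constant outside `[0,1]`). -/
def ext01 (g : C(I01, ℝ)) : ℝ → ℝ := Set.IccExtend zero_le_one ⇑g

/-- `p = (u, u')` encodes a `C¹` function: `u'` is the derivative of `u` on `[0,1]`. -/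
def IsC1 (p : E) : Prop :=
  ∀ t : I01, HasDerivWithinAt (ext01 p.1) (p.2 t) I01 (t : ℝ)

/-- The cone `P` of non-negative `C¹[0,1]` functions with non-negative derivative. -/
def coneP : Set E :=
  {p | IsC1 p ∧ ∀ t : I01, 0 ≤ p.1 t ∧ 0 ≤ p.2 t}

/-- `f̄_ρ = max_{[0,1]×[0,ρ]²} f`. -/
def fSup (f : ℝ → ℝ → ℝ → ℝ) (ρ : ℝ) : ℝ :=
  ⨆ x : I01 × Icc (0:ℝ) ρ × Icc (0:ℝ) ρ, f (x.1 : ℝ) (x.2.1 : ℝ) (x.2.2 : ℝ)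

/-- `f̲_ρ = min_{[0,1]×[0,ρ]²} f`. -/
def fInf (f : ℝ → ℝ → ℝ → ℝ) (ρ : ℝ) : ℝ :=
  ⨅ x : I01 × Icc (0:ℝ) ρ × Icc (0:ℝ) ρ, f (x.1 : ℝ) (x.2.1 : ℝ) (x.2.2 : ℝ)

/-- `H_{i,ρ} = sup {h_i[u] : u ∈ ∂P_ρ}`. -/
def Hsup (h : E → ℝ) (ρ : ℝ) : ℝ := sSup (h '' {p ∈ coneP | ‖p‖ = ρ})

/-- `K = ∫₀¹ k(1,s) ds`. -/
def Kconst (k : ℝ → ℝ → ℝ) : ℝ := ∫ s in (0:ℝ)..1, k 1 s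

/-- `K* = sup_{t∈[0,1]} ∫₀¹ ∂ₜk(t,s) ds`. -/
def Kstar (kt : ℝ → ℝ → ℝ) : ℝ := ⨆ t : I01, ∫ s in (0:ℝ)..1, kt (t : ℝ) s

/-- `‖g‖_∞` for a raw function (sup over `[0,1]`). -/
def supNorm (g : ℝ → ℝ) : ℝ := ⨆ t : I01, |g (t : ℝ)|

theorem continuous_ext01 (g : C(I01, ℝ)) : Continuous (ext01 g) :=
  g.continuous.Icc_extend'

theorem ext01_of_mem (g : C(I01, ℝ)) {t : ℝ} (ht : t ∈ I01) : ext01 g t = g ⟨t, ht⟩ :=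
  Set.IccExtend_of_mem _ _ ht

theorem intervalIntegral_eq_setIntegral_I01 (F : ℝ → ℝ) :
    ∫ s in (0:ℝ)..1, F s = ∫ s in I01, F s := by
  rw [intervalIntegral.integral_of_le zero_le_one, integral_Icc_eq_integral_Ioc]

theorem le_supNorm {g : ℝ → ℝ} (hg : ContinuousOn g I01) {t : ℝ} (ht : t ∈ I01) :
    |g t| ≤ supNorm g := by
  have hc : Continuous fun t : I01 => |g t| := (continuousOn_iff_continuous_domRestrict.1 hg).abs
  exact le_ciSup (isCompact_range hc).bddAbove (⟨t, ht⟩ : I01)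

theorem le_fSup {f : ℝ → ℝ → ℝ → ℝ} {ρ : ℝ}
    (hf : ContinuousOn (fun x : ℝ × ℝ × ℝ => f x.1 x.2.1 x.2.2)
      (I01 ×ˢ Ici (0:ℝ) ×ˢ Ici (0:ℝ)))
    {t u v : ℝ} (ht : t ∈ I01) (hu : u ∈ Icc 0 ρ) (hv : v ∈ Icc 0 ρ) :
    f t u v ≤ fSup f ρ := by
  have hc : Continuous fun x : I01 × Icc (0:ℝ) ρ × Icc (0:ℝ) ρ =>
      f (x.1 : ℝ) (x.2.1 : ℝ) (x.2.2 : ℝ) :=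
    hf.comp_continuous (f := fun x : I01 × Icc (0:ℝ) ρ × Icc (0:ℝ) ρ =>
      ((x.1 : ℝ), (x.2.1 : ℝ), (x.2.2 : ℝ))) (by fun_prop)
      fun x => ⟨x.1.2, x.2.1.2.1, x.2.2.2.1⟩
  exact le_ciSup (isCompact_range hc).bddAbove (⟨⟨t, ht⟩, ⟨u, hu⟩, ⟨v, hv⟩⟩ :
    I01 × Icc (0:ℝ) ρ × Icc (0:ℝ) ρ)

theorem le_Hsup {h : E → ℝ} (hb : ∀ B ⊆ coneP, IsBounded B → IsBounded (h '' B))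
    {p : E} (hp : p ∈ coneP) : h p ≤ Hsup h ‖p‖ := by
  refine le_csSup (hb _ (fun q hq => hq.1) ?_).bddAbove ⟨p, ⟨hp, rfl⟩, rfl⟩
  exact isBounded_iff_forall_norm_le.2 ⟨‖p‖, fun q hq => hq.2.le⟩

theorem integral_le_Kstar {kt : ℝ → ℝ → ℝ} {Ψ : ℝ → ℝ}
    (hkt : ∀ᵐ s ∂(volume.restrict I01), ∀ t ∈ I01, 0 ≤ kt t s ∧ kt t s ≤ Ψ s)
    (hΨ : IntegrableOn Ψ I01) {t : ℝ} (ht : t ∈ I01) :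
    ∫ s in I01, kt t s ≤ Kstar kt := by
  rw [← intervalIntegral_eq_setIntegral_I01]
  refine le_ciSup (f := fun t : I01 => ∫ s in (0:ℝ)..1, kt (t : ℝ) s)
    ⟨∫ s in I01, Ψ s, ?_⟩ (⟨t, ht⟩ : I01)
  rintro _ ⟨x, rfl⟩
  simp only [intervalIntegral_eq_setIntegral_I01]
  exact integral_mono_of_nonneg (hkt.mono fun s hs => (hs x x.2).1) hΨ
    (hkt.mono fun s hs => (hs x x.2).2)

theorem coneP.fst_monotone {p : E} (hp : p ∈ coneP) : MonotoneOn (ext01 p.1) I01 := by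
  have hder : ∀ t ∈ interior I01, ∃ ht : t ∈ I01, HasDerivAt (ext01 p.1) (p.2 ⟨t, ht⟩) t :=
    fun t ht => ⟨interior_subset ht,
      (hp.1 ⟨t, interior_subset ht⟩).hasDerivAt (mem_interior_iff_mem_nhds.1 ht)⟩
  refine monotoneOn_of_deriv_nonneg (convex_Icc 0 1) (continuous_ext01 _).continuousOn ?_ ?_
  · intro t ht
    obtain ⟨_, h⟩ := hder t ht
    exact h.differentiableAt.differentiableWithinAt
  · intro t ht
    obtain ⟨_, h⟩ := hder t ht
    rw [h.deriv]
    exact (hp.2 _).2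

/-- The derivative in `t` of a measurable kernel is a.e. strongly measurable in `s`. -/
theorem aestronglyMeasurable_kernel_deriv {k kt : ℝ → ℝ → ℝ}
    (hk_meas : Measurable (Function.uncurry k)) {t : ℝ}
    (hkt : ∀ᵐ s ∂(volume.restrict I01), HasDerivAt (fun x => k x s) (kt t s) t) :
    AEStronglyMeasurable (kt t) (volume.restrict I01) := by
  have hm : ∀ x, Measurable (k x) := fun x => hk_meas.comp measurable_prodMk_left
  refine aestronglyMeasurable_of_tendsto_ae (nhdsWithin t {t}ᶜ)
    (f := fun x s => slope (fun y => k y s) t x) (fun x => ?_) ?_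
  · simp only [slope_def_field]
    exact (((hm x).sub (hm t)).div_const _).aestronglyMeasurable
  · exact hkt.mono fun s hs => hasDerivAt_iff_tendsto_slope.1 hs

theorem hasDerivAt_integral_kernel_mul {k kt : ℝ → ℝ → ℝ} {Φ Ψ g : ℝ → ℝ} {M : ℝ}
    (hk_meas : Measurable (Function.uncurry k))
    (hk_nonneg : ∀ t ∈ I01, ∀ s ∈ I01, 0 ≤ k t s)
    (hΦ : IntegrableOn Φ I01)
    (hkΦ : ∀ᵐ s ∂(volume.restrict I01), ∀ t ∈ I01, k t s ≤ Φ s)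
    (hkt : ∀ᵐ s ∂(volume.restrict I01), ∀ t ∈ I01,
      HasDerivWithinAt (fun x => k x s) (kt t s) I01 t ∧ 0 ≤ kt t s ∧ kt t s ≤ Ψ s)
    (hΨ : IntegrableOn Ψ I01)
    (hg : AEStronglyMeasurable g (volume.restrict I01))
    (hgM : ∀ᵐ s ∂(volume.restrict I01), ‖g s‖ ≤ M) {t : ℝ} (ht : t ∈ Ioo (0:ℝ) 1) :
    HasDerivAt (fun x => ∫ s in I01, k x s * g s) (∫ s in I01, kt t s * g s) t := by
  have hm : ∀ x, AEStronglyMeasurable (k x) (volume.restrict I01) := fun x =>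
    (hk_meas.comp measurable_prodMk_left).aestronglyMeasurable
  have hder : ∀ᵐ s ∂(volume.restrict I01), ∀ x ∈ Ioo (0:ℝ) 1,
      HasDerivAt (fun x => k x s) (kt x s) x := hkt.mono fun s hs x hx =>
    (hs x (Ioo_subset_Icc_self hx)).1.hasDerivAt (Icc_mem_nhds hx.1 hx.2)
  have hki : Integrable (k t) (volume.restrict I01) := by
    refine hΦ.mono' (hm t) ?_
    filter_upwards [hkΦ, ae_restrict_mem measurableSet_Icc] with s hs hsI
    rw [Real.norm_of_nonneg (hk_nonneg t (Ioo_subset_Icc_self ht) s hsI)]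
    exact hs t (Ioo_subset_Icc_self ht)
  refine (hasDerivAt_integral_of_dominated_loc_of_deriv_le (Ioo_mem_nhds ht.1 ht.2)
    (F' := fun x s => kt x s * g s) (bound := fun s => Ψ s * M)
    (Filter.Eventually.of_forall fun x => (hm x).mul hg) (hki.mul_bdd hg hgM)
    ((aestronglyMeasurable_kernel_deriv hk_meas (hder.mono fun s hs => hs t ht)).mul hg)
    ?_ (hΨ.mul_const M) ?_).2
  · filter_upwards [hkt, hgM] with s hs hsM x hx
    obtain ⟨-, h0, h1⟩ := hs x (Ioo_subset_Icc_self hx)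
    rw [norm_mul, Real.norm_of_nonneg h0]
    exact mul_le_mul h1 hsM (norm_nonneg _) (h0.trans h1)
  · exact hder.mono fun s hs x hx => (hs x hx).mul_const (g s)

/-- A nonnegative integrable kernel integrated against a function with values in `[0, M]`. -/
theorem setIntegral_mul_le {κ g : ℝ → ℝ} {M : ℝ}
    (hκ : IntegrableOn κ I01) (hκ0 : ∀ᵐ s ∂(volume.restrict I01), 0 ≤ κ s)
    (hg : ∀ s ∈ I01, 0 ≤ g s ∧ g s ≤ M) :
    ∫ s in I01, κ s * g s ≤ M * ∫ s in I01, κ s := by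
  rw [mul_comm, ← integral_mul_const]
  refine integral_mono_of_nonneg ?_ (hκ.mul_const M) ?_
  · filter_upwards [hκ0, ae_restrict_mem measurableSet_Icc] with s h0 hs
    exact mul_nonneg h0 (hg s hs).1
  · filter_upwards [hκ0, ae_restrict_mem measurableSet_Icc] with s h0 hs
    exact mul_le_mul_of_nonneg_left (hg s hs).2 h0

/-- The first part of the proof of Theorem 2.2: under the index condition at `R`, if `T` has no
fixed point on `∂P_R` then `σ·u ≠ Tu` for all `u ∈ ∂P_R` and all `σ > 1`. -/
theorem no_large_eigenvalue_on_boundary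
    (k kt : ℝ → ℝ → ℝ) (Φ Ψ : ℝ → ℝ) (f : ℝ → ℝ → ℝ → ℝ)
    (γ₁ γ₂ γ₁' γ₂' : ℝ → ℝ) (η₁ η₂ lam : ℝ) (h₁ h₂ : E → ℝ)
    -- (C₁)
    (hk_meas : Measurable (Function.uncurry k))
    (hk_cont : ∀ᵐ s ∂(volume.restrict I01), ContinuousOn (fun t => k t s) I01)
    (hk_nonneg : ∀ t ∈ I01, ∀ s ∈ I01, 0 ≤ k t s)
    (hΦ : IntegrableOn Φ I01)
    (hkΦ : ∀ᵐ s ∂(volume.restrict I01), ∀ t ∈ I01, k t s ≤ Φ s)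
    -- (C₂)
    (hkt : ∀ᵐ s ∂(volume.restrict I01),
      (∀ t ∈ I01, HasDerivWithinAt (fun x => k x s) (kt t s) I01 t) ∧
      ContinuousOn (fun t => kt t s) I01 ∧
      ∀ t ∈ I01, 0 ≤ kt t s ∧ kt t s ≤ Ψ s)
    (hΨ : IntegrableOn Ψ I01)
    -- (C₃)
    (hf_cont : ContinuousOn (fun x : ℝ × ℝ × ℝ => f x.1 x.2.1 x.2.2)
      (I01 ×ˢ Ici (0:ℝ) ×ˢ Ici (0:ℝ)))
    (hf_nonneg : ∀ t ∈ I01, ∀ u ∈ Ici (0:ℝ), ∀ v ∈ Ici (0:ℝ), 0 ≤ f t u v)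
    -- (C₄)
    (hγ₁ : ∀ t ∈ I01, HasDerivWithinAt γ₁ (γ₁' t) I01 t)
    (hγ₂ : ∀ t ∈ I01, HasDerivWithinAt γ₂ (γ₂' t) I01 t)
    (hγ₁'c : ContinuousOn γ₁' I01) (hγ₂'c : ContinuousOn γ₂' I01)
    (hγ_nonneg : ∀ t ∈ I01, 0 ≤ γ₁ t ∧ 0 ≤ γ₂ t ∧ 0 ≤ γ₁' t ∧ 0 ≤ γ₂' t)
    -- (C₅)
    (hη₁ : 0 ≤ η₁) (hη₂ : 0 ≤ η₂) (hlam : 0 ≤ lam)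
    -- (C₆)
    (hh₁_nonneg : ∀ p ∈ coneP, 0 ≤ h₁ p) (hh₂_nonneg : ∀ p ∈ coneP, 0 ≤ h₂ p)
    (hh₁_cont : ContinuousOn h₁ coneP) (hh₂_cont : ContinuousOn h₂ coneP)
    (hh₁_bdd : ∀ B ⊆ coneP, IsBounded B → IsBounded (h₁ '' B))
    (hh₂_bdd : ∀ B ⊆ coneP, IsBounded B → IsBounded (h₂ '' B))
    (R : ℝ) (hR : 0 < R)
    (hidx1 : max (lam * fSup f R * Kconst k + η₁ * γ₁ 1 * Hsup h₁ R + η₂ * γ₂ 1 * Hsup h₂ R)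
        (lam * fSup f R * Kstar kt + η₁ * supNorm γ₁' * Hsup h₁ R +
          η₂ * supNorm γ₂' * Hsup h₂ R) ≤ R)
    (hnofix : ¬ ∃ p ∈ coneP, ‖p‖ = R ∧
      ∀ t : I01, p.1 t = η₁ * γ₁ (t : ℝ) * h₁ p + η₂ * γ₂ (t : ℝ) * h₂ p +
        lam * ∫ s in (0:ℝ)..1, k (t : ℝ) s * f s (ext01 p.1 s) (ext01 p.2 s)) :
    ∀ p ∈ coneP, ‖p‖ = R → ∀ σ : ℝ, 1 < σ →
      ¬ ∀ t : I01, σ * p.1 t = η₁ * γ₁ (t : ℝ) * h₁ p + η₂ * γ₂ (t : ℝ) * h₂ p +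
        lam * ∫ s in (0:ℝ)..1, k (t : ℝ) s * f s (ext01 p.1 s) (ext01 p.2 s) := by
  intro p hp hpR σ hσ heq
  have hσ0 : 0 < σ := one_pos.trans hσ
  obtain ⟨hidx, hidx'⟩ := max_le_iff.1 hidx1
  have hone : (1:ℝ) ∈ I01 := ⟨zero_le_one, le_rfl⟩
  have hp1R : ∀ t : I01, p.1 t ≤ R := fun t =>
    (le_abs_self _).trans ((p.1.norm_coe_le_norm t).trans ((norm_fst_le p).trans_eq hpR))
  have hp2R : ∀ t : I01, p.2 t ≤ R := fun t =>
    (le_abs_self _).trans ((p.2.norm_coe_le_norm t).trans ((norm_snd_le p).trans_eq hpR))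
  have hH₁ : h₁ p ≤ Hsup h₁ R := hpR ▸ le_Hsup hh₁_bdd hp
  have hH₂ : h₂ p ≤ Hsup h₂ R := hpR ▸ le_Hsup hh₂_bdd hp
  have h₁0 := hh₁_nonneg p hp
  have h₂0 := hh₂_nonneg p hp
  set g : ℝ → ℝ := fun s => f s (ext01 p.1 s) (ext01 p.2 s) with hg_def
  have hmem : ∀ s ∈ I01, ext01 p.1 s ∈ Icc 0 R ∧ ext01 p.2 s ∈ Icc 0 R := fun s hs => by
    rw [ext01_of_mem _ hs, ext01_of_mem _ hs]
    exact ⟨⟨(hp.2 _).1, hp1R _⟩, ⟨(hp.2 _).2, hp2R _⟩⟩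
  have hg : ∀ s ∈ I01, 0 ≤ g s ∧ g s ≤ fSup f R := fun s hs =>
    ⟨hf_nonneg s hs _ (hmem s hs).1.1 _ (hmem s hs).2.1,
      le_fSup hf_cont hs (hmem s hs).1 (hmem s hs).2⟩
  have hgc : ContinuousOn g I01 :=
    hf_cont.comp (f := fun s => (s, ext01 p.1 s, ext01 p.2 s))
      (continuous_id.prodMk
        ((continuous_ext01 p.1).prodMk (continuous_ext01 p.2))).continuousOn
      fun s hs => ⟨hs, (hmem s hs).1.1, (hmem s hs).2.1⟩
  have hgm : AEStronglyMeasurable g (volume.restrict I01) :=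
    hgc.aestronglyMeasurable measurableSet_Icc
  have hgM : ∀ᵐ s ∂(volume.restrict I01), ‖g s‖ ≤ fSup f R := by
    filter_upwards [ae_restrict_mem measurableSet_Icc] with s hs
    rw [Real.norm_of_nonneg (hg s hs).1]
    exact (hg s hs).2
  have hM0 : 0 ≤ fSup f R := (hg 1 hone).1.trans (hg 1 hone).2
  have hkt' : ∀ᵐ s ∂(volume.restrict I01), ∀ t ∈ I01, 0 ≤ kt t s ∧ kt t s ≤ Ψ s :=
    hkt.mono fun s hs => hs.2.2
  simp only [intervalIntegral_eq_setIntegral_I01] at heq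
  have hvalue : σ * p.1 ⟨1, hone⟩ ≤ R := by
    have hk0 : ∀ᵐ s ∂(volume.restrict I01), 0 ≤ k 1 s := by
      filter_upwards [ae_restrict_mem measurableSet_Icc] with s hs
      exact hk_nonneg 1 hone s hs
    have hki : IntegrableOn (k 1) I01 := by
      refine hΦ.mono' (hk_meas.comp measurable_prodMk_left).aestronglyMeasurable ?_
      filter_upwards [hkΦ, hk0] with s hs hs0
      rw [Real.norm_of_nonneg hs0]
      exact hs 1 hone
    have hint : ∫ s in I01, k 1 s * g s ≤ fSup f R * Kconst k := by
      rw [Kconst, intervalIntegral_eq_setIntegral_I01]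
      exact setIntegral_mul_le hki hk0 hg
    obtain ⟨hγ1, hγ2, -⟩ := hγ_nonneg 1 hone
    rw [heq ⟨1, hone⟩]
    have e1 := mul_le_mul_of_nonneg_left hint hlam
    have e2 := mul_le_mul_of_nonneg_left hH₁ (mul_nonneg hη₁ hγ1)
    have e3 := mul_le_mul_of_nonneg_left hH₂ (mul_nonneg hη₂ hγ2)
    simp only
    linarith
  have hderiv : ∀ t ∈ Ioo (0:ℝ) 1, σ * ext01 p.2 t ≤ R := by
    intro t ht
    have htI : t ∈ I01 := Ioo_subset_Icc_self ht
    have hnhds : I01 ∈ nhds t := Icc_mem_nhds ht.1 ht.2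
    have hleft : HasDerivAt (fun x => σ * ext01 p.1 x) (σ * p.2 ⟨t, htI⟩) t :=
      ((hp.1 ⟨t, htI⟩).hasDerivAt hnhds).const_mul σ
    have hright := (((((hγ₁ t htI).hasDerivAt hnhds).const_mul η₁).mul_const (h₁ p)).add
      ((((hγ₂ t htI).hasDerivAt hnhds).const_mul η₂).mul_const (h₂ p))).add
      ((hasDerivAt_integral_kernel_mul hk_meas hk_nonneg hΦ hkΦ
        (hkt.mono fun s hs t ht => ⟨hs.1 t ht, hs.2.2 t ht⟩) hΨ hgm hgM ht).const_mul lam)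
    have hEq := hleft.unique (hright.congr_of_eventuallyEq (by
      filter_upwards [hnhds] with x hx
      rw [ext01_of_mem _ hx]
      exact heq ⟨x, hx⟩))
    have hkti : IntegrableOn (kt t) I01 := by
      refine hΨ.mono' (aestronglyMeasurable_kernel_deriv hk_meas
        (hkt.mono fun s hs => (hs.1 t htI).hasDerivAt hnhds)) (hkt'.mono fun s hs => ?_)
      rw [Real.norm_of_nonneg (hs t htI).1]
      exact (hs t htI).2
    have hint : ∫ s in I01, kt t s * g s ≤ fSup f R * Kstar kt :=
      (setIntegral_mul_le hkti (hkt'.mono fun s hs => (hs t htI).1) hg).trans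
        (mul_le_mul_of_nonneg_left (integral_le_Kstar hkt' hΨ htI) hM0)
    obtain ⟨-, -, hγ1, hγ2⟩ := hγ_nonneg t htI
    have s1 : γ₁' t ≤ supNorm γ₁' := (le_abs_self _).trans (le_supNorm hγ₁'c htI)
    have s2 : γ₂' t ≤ supNorm γ₂' := (le_abs_self _).trans (le_supNorm hγ₂'c htI)
    have e1 := mul_le_mul_of_nonneg_left hint hlam
    have e2 := mul_le_mul (mul_le_mul_of_nonneg_left s1 hη₁) hH₁ h₁0
      (mul_nonneg hη₁ (hγ1.trans s1))
    have e3 := mul_le_mul (mul_le_mul_of_nonneg_left s2 hη₂) hH₂ h₂0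
      (mul_nonneg hη₂ (hγ2.trans s2))
    rw [ext01_of_mem _ htI, hEq]
    linarith
  have hderiv' : ∀ t ∈ I01, σ * ext01 p.2 t ≤ R := by
    intro t ht
    rw [I01, ← closure_Ioo (zero_ne_one' ℝ)] at ht
    exact le_on_closure hderiv ((continuous_ext01 p.2).const_mul σ).continuousOn
      continuousOn_const ht
  have hRσ : 0 ≤ R / σ := (div_pos hR hσ0).le
  have hnorm : ‖p‖ ≤ R / σ := by
    refine max_le ((ContinuousMap.norm_le _ hRσ).2 fun t => ?_)
      ((ContinuousMap.norm_le _ hRσ).2 fun t => ?_)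
    · rw [Real.norm_of_nonneg (hp.2 t).1, le_div_iff₀' hσ0]
      have hmono := coneP.fst_monotone hp t.2 hone t.2.2
      rw [ext01_of_mem _ t.2, ext01_of_mem _ hone] at hmono
      exact (mul_le_mul_of_nonneg_left hmono hσ0.le).trans hvalue
    · rw [Real.norm_of_nonneg (hp.2 t).2, le_div_iff₀' hσ0]
      have h := hderiv' t t.2
      rwa [ext01_of_mem _ t.2] at h
  exact (hnorm.trans_lt (div_lt_self hR hσ)).ne hpR
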